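/- Let W > 0, A ≥ 0, δ > 0 and B ≥ 1 be real constants with D := (B−1)² − 4(A+δ) ≥ 0. Define μ(s) = (s+W)^{(1−B+√D)/2} for s ∈ [0, ∞). Then μ(s) > 0 and μ'(s) < 0 for all s ≥ 0, and for all functions Φ, Ψ : [0, ∞) → ℝ satisfying Φ(s) ≤ A/(s+W)² and Ψ(s) ≥ B/(s+W) for all s ≥ 0, one has Φ(s)μ(s) + Ψ(s)μ'(s) + μ''(s) ≤ −δ·μ(s)/(s+W)² < 0 for all s ≥ 0. -/

import Mathlib

theorem deriv_add_const_rpow {s W : ℝ} (p : ℝ) (hs : 0 < s + W) :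
    deriv (fun x : ℝ => (x + W) ^ p) s = p * (s + W) ^ (p - 1) := by
  rw [deriv_comp_add_const (fun y : ℝ => y ^ p)]
  exact (Real.hasDerivAt_rpow_const (Or.inl hs.ne')).deriv

theorem deriv_deriv_add_const_rpow {s W : ℝ} (p : ℝ) (hs : 0 < s + W) :
    deriv (deriv fun x : ℝ => (x + W) ^ p) s = p * ((p - 1) * (s + W) ^ (p - 1 - 1)) := by
  have h : deriv (fun x : ℝ => (x + W) ^ p) =ᶠ[nhds s]
      fun x => p * (x + W) ^ (p - 1) := by
    have hpos : ∀ᶠ x in nhds s, 0 < x + W :=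
      (continuous_id.add continuous_const).continuousAt.eventually (lt_mem_nhds hs)
    filter_upwards [hpos] with x hx using deriv_add_const_rpow p hx
  rw [h.deriv_eq, deriv_const_mul_field, deriv_add_const_rpow _ hs]

/-- Decreasing power test function (case B ≥ 1, nonnegative discriminant):
μ(s) = (s+W)^{(1−B+√D)/2} is positive and decreasing on [0,∞), and for all
Φ ≤ A/(s+W)², Ψ ≥ B/(s+W) one has Φμ + Ψμ' + μ'' ≤ −δμ/(s+W)² < 0. -/
theorem test_function_power_decreasing
    (W A δ B : ℝ) (hW : 0 < W) (hA : 0 ≤ A) (hδ : 0 < δ) (hB : 1 ≤ B)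
    (hD : 0 ≤ (B - 1) ^ 2 - 4 * (A + δ))
    (μ : ℝ → ℝ)
    (hμ : μ = fun s : ℝ =>
      (s + W) ^ ((1 - B + Real.sqrt ((B - 1) ^ 2 - 4 * (A + δ))) / 2)) :
    (∀ s : ℝ, 0 ≤ s → 0 < μ s ∧ deriv μ s < 0) ∧
    (∀ Φ Ψ : ℝ → ℝ,
      (∀ s : ℝ, 0 ≤ s → Φ s ≤ A / (s + W) ^ 2) →
      (∀ s : ℝ, 0 ≤ s → B / (s + W) ≤ Ψ s) →
      ∀ s : ℝ, 0 ≤ s →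
        Φ s * μ s + Ψ s * deriv μ s + deriv (deriv μ) s ≤ -δ * μ s / (s + W) ^ 2 ∧
        -δ * μ s / (s + W) ^ 2 < 0) := by
  set D := (B - 1) ^ 2 - 4 * (A + δ)
  set p := (1 - B + Real.sqrt D) / 2 with hp
  have hsq : Real.sqrt D ^ 2 = (B - 1) ^ 2 - 4 * (A + δ) := Real.sq_sqrt hD
  have hp_neg : p < 0 := by
    have : Real.sqrt D < B - 1 := lt_of_pow_lt_pow_left₀ 2 (by linarith) (by linarith)
    linarith
  have hchar : p * (p - 1) + B * p + A = -δ := by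
    rw [hp]
    linear_combination hsq / 4
  have hpos : ∀ s : ℝ, 0 ≤ s → 0 < s + W := fun s hs => by linarith
  subst hμ
  refine ⟨fun s hs => ⟨Real.rpow_pos_of_pos (hpos s hs) p, ?_⟩, fun Φ Ψ hΦ hΨ s hs => ⟨?_, ?_⟩⟩
  · rw [deriv_add_const_rpow p (hpos s hs)]
    exact mul_neg_of_neg_of_pos hp_neg (Real.rpow_pos_of_pos (hpos s hs) _)
  · have ht := hpos s hs
    rw [deriv_deriv_add_const_rpow p ht, deriv_add_const_rpow p ht]
    have hm : 0 < (s + W) ^ p := Real.rpow_pos_of_pos ht p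
    have hm' : 0 < (s + W) ^ (p - 1) := Real.rpow_pos_of_pos ht _
    calc
      _ ≤ A / (s + W) ^ 2 * (s + W) ^ p + B / (s + W) * (p * (s + W) ^ (p - 1))
          + p * ((p - 1) * (s + W) ^ (p - 1 - 1)) :=
        add_le_add_left (add_le_add (mul_le_mul_of_nonneg_right (hΦ s hs) hm.le)
          (mul_le_mul_of_nonpos_right (hΨ s hs)
            (mul_neg_of_neg_of_pos hp_neg hm').le)) _
      _ = (p * (p - 1) + B * p + A) * (s + W) ^ p / (s + W) ^ 2 := by
        rw [Real.rpow_sub_one ht.ne' (p - 1), Real.rpow_sub_one ht.ne' p]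
        field_simp
        ring
      _ = _ := by rw [hchar]
  · have ht := hpos s hs
    exact div_neg_of_neg_of_pos
      (mul_neg_of_neg_of_pos (neg_lt_zero.mpr hδ) (Real.rpow_pos_of_pos ht p)) (pow_pos ht 2)
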